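/- arXiv:2311.09597 — 10 statements merged into one kernel-verified Lean document; each statement's English description precedes it below -/
import Mathlib

section
/- Under the stated setup, the evolution operator Û : ℝ → (E →L[ℂ] E) is differentiable, and its derivative satisfies, for every t, the operator differential equation Û'(t) = P'(t) ∘ Û(t) + Û(t) ∘ F̂(t). -/
open Matrix ContinuousLinearMap
open scoped ComplexConjugate

local notation "⟪" x ", " y "⟫" => @inner ℂ _ _ x y

/-- The rank-one operator `|x⟩⟨y|` sending `z` to `⟪y, z⟫ • x`. -/
noncomputable def ketbra {E : Type*} [NormedAddCommGroup E] [InnerProductSpace ℂ E]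
    (x y : E) : E →L[ℂ] E :=
  (innerSL ℂ y).smulRight x

theorem ketbra_isBoundedBilinear {E : Type*} [NormedAddCommGroup E] [InnerProductSpace ℂ E] :
    IsBoundedBilinearMap ℝ (fun p : E × E => ketbra p.1 p.2) where
  add_left x x' y := by ext z; simp [ketbra]
  smul_left c x y := by
    ext z
    simp only [ketbra, ContinuousLinearMap.smulRight_apply, _root_.smul_apply]
    rw [smul_comm]
  add_right x y y' := by ext z; simp [ketbra, add_smul, inner_add_left]
  smul_right c x y := by
    ext z
    simp only [ketbra, ContinuousLinearMap.smulRight_apply, _root_.smul_apply,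
      innerSL_apply_apply]
    rw [← Complex.coe_smul c y, inner_smul_left, Complex.conj_ofReal, mul_smul,
      Complex.coe_smul]
  bound := ⟨1, one_pos, fun x y => by
    have := InnerProductSpace.norm_rankOne (𝕜 := ℂ) x y
    rw [one_mul]; exact this.le⟩

theorem ketbra_hasDerivAt {E : Type*} [NormedAddCommGroup E] [InnerProductSpace ℂ E]
    {f g : ℝ → E} {f' g' : E} {t : ℝ} (hf : HasDerivAt f f' t) (hg : HasDerivAt g g' t) :
    HasDerivAt (fun s => ketbra (f s) (g s)) (ketbra (f t) g' + ketbra f' (g t)) t := by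
  have h := (ketbra_isBoundedBilinear (E := E)).hasFDerivAt (f t, g t)
  exact h.comp_hasDerivAt t (hf.prodMk hg)

theorem ketbra_mul {E : Type*} [NormedAddCommGroup E] [InnerProductSpace ℂ E]
    (a b c d : E) : ketbra a b * ketbra c d = (inner ℂ b c) • ketbra a d := by
  ext z
  simp [ketbra, inner_smul_right, smul_smul, mul_comm]

/-- The evolution operator `Û` is differentiable and satisfies
`Û'(t) = P'(t) ∘ Û(t) + Û(t) ∘ F̂(t)`. -/
theorem evolution_operator_differential_equation
    {E : Type*} [NormedAddCommGroup E] [InnerProductSpace ℂ E] [FiniteDimensional ℂ E]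
    (ℓ : ℕ) (hℓ : 0 < ℓ)
    (H : ℝ → E →L[ℂ] E) (hHcont : Continuous H) (hHsa : ∀ t, IsSelfAdjoint (H t))
    (ψ : Fin ℓ → ℝ → E)
    (hψsmooth : ∀ i, ContDiff ℝ 1 (ψ i))
    (hSchr : ∀ i t, HasDerivAt (ψ i) ((-Complex.I) • (H t) (ψ i t)) t)
    (hON : ∀ i j t, ⟪ψ i t, ψ j t⟫ = if i = j then (1 : ℂ) else 0)
    (P : ℝ → E →L[ℂ] E) (hP : ∀ t, P t = ∑ i, ketbra (ψ i t) (ψ i t))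
    (Uhat : ℝ → E →L[ℂ] E) (hUhat : ∀ t, Uhat t = ∑ j, ketbra (ψ j t) (ψ j 0))
    (F : ℝ → Matrix (Fin ℓ) (Fin ℓ) ℂ)
    (hF : ∀ t i j, F t i j = -Complex.I * ⟪ψ i t, (H t) (ψ j t)⟫)
    (Fhat : ℝ → E →L[ℂ] E)
    (hFhat : ∀ t, Fhat t = ∑ i, ∑ j, F t i j • ketbra (ψ i 0) (ψ j 0)) :
    ∀ t, HasDerivAt Uhat (deriv P t ∘L Uhat t + Uhat t ∘L Fhat t) t := by
  intro t
  have hU : HasDerivAt Uhat (∑ j, ketbra ((-Complex.I) • (H t) (ψ j t)) (ψ j 0)) t := by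
    rw [show Uhat = _ from funext hUhat]
    refine HasDerivAt.fun_sum fun j _ => ?_
    have := ketbra_hasDerivAt (hSchr j t) (hasDerivAt_const t (ψ j 0))
    have h0 : ketbra (ψ j t) (0 : E) = 0 := by ext z; simp [ketbra]
    rwa [h0, zero_add] at this
  have hPd : HasDerivAt P (deriv P t) t := by
    apply DifferentiableAt.hasDerivAt
    rw [show P = _ from funext hP]
    exact (HasDerivAt.fun_sum fun j _ =>
      ketbra_hasDerivAt (hSchr j t) (hSchr j t)).differentiableAt
  have hPU : P * Uhat = Uhat := by
    funext s
    rw [Pi.mul_apply, hP, hUhat, Finset.sum_mul_sum]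
    simp [ketbra_mul, hON]
  have hm := hPd.mul hU
  rw [hPU] at hm
  have key : Uhat t * Fhat t =
      P t * ∑ j, ketbra ((-Complex.I) • (H t) (ψ j t)) (ψ j 0) := by
    rw [hP, hUhat, hFhat, Finset.sum_mul_sum, Finset.sum_mul_sum]
    refine Finset.sum_congr rfl fun i _ => ?_
    simp only [Finset.mul_sum, mul_smul_comm, ketbra_mul, hON, inner_smul_right, hF]
    rw [Finset.sum_comm]
    simp
  rw [← key] at hm
  exact hm
end

section
/- (Theorem 1: separation of the evolution operator into holonomy and dynamic operators.) Under the stated setup, suppose Γ̂ : ℝ → (E →L[ℂ] E) is differentiable with Γ̂'(t) = P'(t) ∘ Γ̂(t) for all t and Γ̂(0) = P(0) (the holonomy operator), and suppose D̂ : ℝ → (E →L[ℂ] E) is differentiable with D̂'(t) = D̂(t) ∘ F̂(t) for all t and D̂(0) = P(0) (the dynamic operator). Then the evolution operator factorizes as Û(t) = Γ̂(t) ∘ D̂(t) for every t. -/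
open Matrix ContinuousLinearMap
open scoped ComplexConjugate

local notation "⟪" x ", " y "⟫" => @inner ℂ _ _ x y

theorem ketbra_apply {E : Type*} [NormedAddCommGroup E] [InnerProductSpace ℂ E]
    (x y z : E) : ketbra x y z = ⟪y, z⟫ • x := by
  simp [ketbra]

theorem ketbra_bilin {E : Type*} [NormedAddCommGroup E] [InnerProductSpace ℂ E] :
    IsBoundedBilinearMap ℝ (fun p : E × E => ketbra p.1 p.2) where
  add_left x y z := by ext w; simp [ketbra_apply]
  smul_left c x y := by
    ext w
    simp only [ketbra_apply, ContinuousLinearMap.smul_apply]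
    rw [smul_comm]
  add_right x y z := by ext w; simp [ketbra_apply, inner_add_left, add_smul]
  smul_right c x y := by
    ext w
    simp only [ketbra_apply, ContinuousLinearMap.smul_apply]
    rw [← Complex.coe_smul, inner_smul_left, mul_smul, Complex.conj_ofReal, Complex.coe_smul]
  bound := ⟨1, one_pos, fun x y => by
    simp [ketbra, ContinuousLinearMap.norm_smulRight_apply, mul_comm]⟩

theorem ketbra_hasDerivAt_s2 {E : Type*} [NormedAddCommGroup E] [InnerProductSpace ℂ E]
    {x y : ℝ → E} {x' y' : E} {t : ℝ} (hx : HasDerivAt x x' t) (hy : HasDerivAt y y' t) :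
    HasDerivAt (fun s => ketbra (x s) (y s)) (ketbra (x t) y' + ketbra x' (y t)) t := by
  have h := (ketbra_bilin (E := E)).hasFDerivAt (x t, y t)
  have h2 := h.comp_hasDerivAt t (hx.prodMk hy)
  simp only [IsBoundedBilinearMap.deriv_apply] at h2
  exact h2

theorem linear_ode_zero {A : Type*} [NormedRing A] [NormedAlgebra ℝ A]
    {L R X : ℝ → A} (hL : Continuous L) (hR : Continuous R)
    (hX : ∀ t, HasDerivAt X (L t * X t + X t * R t) t) (h0 : X 0 = 0) (t : ℝ) : X t = 0 := by
  set a := -(|t| + 1) with ha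
  set b := |t| + 1 with hb
  obtain ⟨C, hC⟩ := (isCompact_Icc (a := a) (b := b)).exists_bound_of_continuousOn
    (f := fun s => ‖L s‖ + ‖R s‖) (by fun_prop)
  have key := ODE_solution_unique_of_mem_Icc (v := fun s x => L s * x + x * R s)
    (s := fun _ => Set.univ) (K := C.toNNReal) (f := X) (g := fun _ => 0) (a := a) (b := b)
    (t₀ := 0) ?_ ?_ ?_ ?_ ?_ ?_ ?_ ?_ ?_
  · exact key (x := t) ⟨by linarith [neg_abs_le t], by linarith [le_abs_self t]⟩
  · intro s hs
    apply LipschitzWith.lipschitzOnWith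
    apply LipschitzWith.of_dist_le_mul
    intro x y
    rw [dist_eq_norm, dist_eq_norm]
    have e : L s * x + x * R s - (L s * y + y * R s) = L s * (x - y) + (x - y) * R s := by
      noncomm_ring
    rw [e]
    have h1 := norm_add_le (L s * (x - y)) ((x - y) * R s)
    have h2 := norm_mul_le (L s) (x - y)
    have h3 := norm_mul_le (x - y) (R s)
    have h4 := (le_abs_self _).trans (hC s (Set.Ioo_subset_Icc_self hs))
    have h5 : C ≤ (C.toNNReal : ℝ) := Real.le_coe_toNNReal C
    nlinarith [norm_nonneg (x - y)]
  · constructor <;> linarith [abs_nonneg t]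
  · exact fun s _ => (hX s).continuousAt.continuousWithinAt
  · exact fun s _ => hX s
  · simp
  · fun_prop
  · intro s _
    simpa using hasDerivAt_const s (0 : A)
  · simp
  · exact h0

/-- Theorem 1: the evolution operator always separates into the product of the
holonomy operator and the dynamic operator, `Û(t) = Γ̂(t) ∘ D̂(t)`. -/
theorem evolution_operator_separation
    {E : Type*} [NormedAddCommGroup E] [InnerProductSpace ℂ E] [FiniteDimensional ℂ E]
    (ℓ : ℕ) (hℓ : 0 < ℓ)
    (H : ℝ → E →L[ℂ] E) (hHcont : Continuous H) (hHsa : ∀ t, IsSelfAdjoint (H t))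
    (ψ : Fin ℓ → ℝ → E)
    (hψsmooth : ∀ i, ContDiff ℝ 1 (ψ i))
    (hSchr : ∀ i t, HasDerivAt (ψ i) ((-Complex.I) • (H t) (ψ i t)) t)
    (hON : ∀ i j t, ⟪ψ i t, ψ j t⟫ = if i = j then (1 : ℂ) else 0)
    (P : ℝ → E →L[ℂ] E) (hP : ∀ t, P t = ∑ i, ketbra (ψ i t) (ψ i t))
    (Uhat : ℝ → E →L[ℂ] E) (hUhat : ∀ t, Uhat t = ∑ j, ketbra (ψ j t) (ψ j 0))
    (F : ℝ → Matrix (Fin ℓ) (Fin ℓ) ℂ)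
    (hF : ∀ t i j, F t i j = -Complex.I * ⟪ψ i t, (H t) (ψ j t)⟫)
    (Fhat : ℝ → E →L[ℂ] E)
    (hFhat : ∀ t, Fhat t = ∑ i, ∑ j, F t i j • ketbra (ψ i 0) (ψ j 0))
    (Γhat : ℝ → E →L[ℂ] E)
    (hΓODE : ∀ t, HasDerivAt Γhat (deriv P t ∘L Γhat t) t)
    (hΓ0 : Γhat 0 = P 0)
    (Dhat : ℝ → E →L[ℂ] E)
    (hDODE : ∀ t, HasDerivAt Dhat (Dhat t ∘L Fhat t) t)
    (hD0 : Dhat 0 = P 0) :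
    ∀ t, Uhat t = Γhat t ∘L Dhat t := by
  classical
  have hcont : ∀ i, Continuous (ψ i) := fun i => (hψsmooth i).continuous
  have hdc : ∀ i, Continuous (fun t => (-Complex.I) • (H t) (ψ i t)) := fun i =>
    (hHcont.clm_apply (hcont i)).const_smul _
  have hkc : ∀ {x y : ℝ → E}, Continuous x → Continuous y →
      Continuous (fun t => ketbra (x t) (y t)) := fun hx hy =>
    (ketbra_bilin (E := E)).continuous.comp (hx.prodMk hy)
  have hP' : ∀ t, HasDerivAt P (∑ i, (ketbra (ψ i t) ((-Complex.I) • (H t) (ψ i t)) +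
      ketbra ((-Complex.I) • (H t) (ψ i t)) (ψ i t))) t := by
    intro t
    have e : P = fun t => ∑ i, ketbra (ψ i t) (ψ i t) := funext hP
    rw [e]
    exact HasDerivAt.fun_sum fun i _ => ketbra_hasDerivAt_s2 (hSchr i t) (hSchr i t)
  have hPc : Continuous (deriv P) := by
    have e : deriv P = _ := funext fun t => (hP' t).deriv
    rw [e]
    exact continuous_finsetSum _ fun i _ => (hkc (hcont i) (hdc i)).add (hkc (hdc i) (hcont i))
  have hFc : Continuous Fhat := by
    have e : Fhat = _ := funext hFhat
    rw [e]
    refine continuous_finsetSum _ fun i _ => continuous_finsetSum _ fun j _ => ?_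
    simp only [hF]
    have : Continuous fun t => ⟪ψ i t, (H t) (ψ j t)⟫ :=
      (hcont i).inner (hHcont.clm_apply (hcont j))
    exact (this.const_mul _).smul continuous_const
  have hU' : ∀ t, HasDerivAt Uhat (∑ j, ketbra ((-Complex.I) • (H t) (ψ j t)) (ψ j 0)) t := by
    intro t
    have e : Uhat = _ := funext hUhat
    rw [e]
    refine HasDerivAt.fun_sum fun i _ => ?_
    have := ketbra_hasDerivAt_s2 (hSchr i t) (hasDerivAt_const t (ψ i 0))
    have z : ketbra (ψ i t) (0 : E) = 0 := by ext w; simp [ketbra_apply]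
    simpa [z] using this
  have hPU : ∀ t, P t * Uhat t = Uhat t := by
    intro t
    ext z
    simp [hP, hUhat, ketbra_apply, ContinuousLinearMap.sum_apply, inner_sum, inner_smul_right, hON]
  have hPU' : ∀ t, P t * (∑ j, ketbra ((-Complex.I) • (H t) (ψ j t)) (ψ j 0))
      = Uhat t * Fhat t := by
    intro t
    ext z
    simp only [hP, hUhat, hFhat, ketbra_apply, ContinuousLinearMap.sum_apply, inner_sum,
      inner_smul_right, hON, hF, ContinuousLinearMap.mul_apply, ContinuousLinearMap.smul_apply,
      Finset.sum_smul, mul_ite, mul_one, mul_zero]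
    refine Finset.sum_congr rfl fun i _ => ?_
    rw [Finset.sum_comm]
    refine Finset.sum_congr rfl fun j _ => ?_
    simp [mul_comm, mul_left_comm]
  have hUode : ∀ t, HasDerivAt Uhat (deriv P t * Uhat t + Uhat t * Fhat t) t := by
    intro t
    have h := ((hP' t).differentiableAt.hasDerivAt).mul (hU' t)
    rw [hPU'] at h
    have e : P * Uhat = Uhat := funext hPU
    rwa [e] at h
  have hWode : ∀ t, HasDerivAt (fun t => Γhat t * Dhat t)
      (deriv P t * (Γhat t * Dhat t) + (Γhat t * Dhat t) * Fhat t) t := by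
    intro t
    have h := HasDerivAt.mul (hΓODE t) (hDODE t)
    have e : (deriv P t ∘L Γhat t) * Dhat t + Γhat t * (Dhat t ∘L Fhat t) =
      deriv P t * (Γhat t * Dhat t) + (Γhat t * Dhat t) * Fhat t := rfl
    rw [e] at h
    exact h
  intro t
  have hz := linear_ode_zero (X := fun t => Uhat t - Γhat t * Dhat t) hPc hFc ?_ ?_ t
  · exact sub_eq_zero.mp hz
  · intro s
    have h := (hUode s).sub (hWode s)
    have e : deriv P s * Uhat s + Uhat s * Fhat s - (deriv P s * (Γhat s * Dhat s) +
        Γhat s * Dhat s * Fhat s) = deriv P s * (Uhat s - Γhat s * Dhat s) +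
        (Uhat s - Γhat s * Dhat s) * Fhat s := by noncomm_ring
    rw [e] at h
    exact h
  · have e : Uhat 0 = P 0 := by rw [hUhat, hP]
    have := hPU 0
    simp only [hΓ0, hD0]
    rw [e] at this ⊢
    rw [this, sub_self]
end

section
/- Let P : ℝ → (E →L[ℂ] E) be a continuously differentiable family of orthogonal projections, and let Γ̂ : ℝ → (E →L[ℂ] E) be differentiable with Γ̂'(t) = P'(t) ∘ Γ̂(t) for all t and Γ̂(0) = P(0). Then the range of the holonomy operator stays in the moving subspace: P(t) ∘ Γ̂(t) = Γ̂(t) for every t. -/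
open Matrix ContinuousLinearMap

/-- Uniqueness (forward in time) for a linear ODE with continuous coefficient. -/
theorem linear_ode_zero_forward {A : Type*} [NormedRing A] [NormedAlgebra ℝ A]
    (a D : ℝ → A) (ha : Continuous a) (hD : ∀ t, HasDerivAt D (a t * D t) t)
    (h0 : D 0 = 0) (t : ℝ) (ht : 0 ≤ t) : D t = 0 := by
  obtain ⟨K, hK⟩ := (isCompact_Icc (a := (0 : ℝ)) (b := t)).exists_bound_of_continuousOn
    ha.continuousOn
  refine eq_zero_of_abs_deriv_le_mul_abs_self_of_eq_zero_right (K := K) (a := 0) (b := t)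
    (f' := fun s => a s * D s)
    (fun s _ => (hD s).continuousAt.continuousWithinAt)
    (fun s _ => (hD s).hasDerivWithinAt) h0 (fun s hs => ?_) t ⟨ht, le_rfl⟩
  exact (norm_mul_le _ _).trans
    (mul_le_mul_of_nonneg_right (hK s ⟨hs.1, hs.2.le⟩) (norm_nonneg _))

theorem linear_ode_zero_s3 {A : Type*} [NormedRing A] [NormedAlgebra ℝ A]
    (a D : ℝ → A) (ha : Continuous a) (hD : ∀ t, HasDerivAt D (a t * D t) t)
    (h0 : D 0 = 0) (t : ℝ) : D t = 0 := by
  rcases le_total 0 t with ht | ht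
  · exact linear_ode_zero_forward a D ha hD h0 t ht
  · have := linear_ode_zero_forward (fun s => -a (-s)) (fun s => D (-s))
      (ha.comp continuous_neg).neg (fun s => ?_) (by simpa using h0) (-t) (by linarith)
    · simpa using this
    · have h := (hD (-s)).scomp s (hasDerivAt_neg s)
      simpa [Function.comp_def] using h

/-- The range of the holonomy operator stays in the moving subspace:
`P(t) ∘ Γ̂(t) = Γ̂(t)` for every `t`. -/
theorem holonomy_operator_range
    {E : Type*} [NormedAddCommGroup E] [InnerProductSpace ℂ E] [FiniteDimensional ℂ E]
    (P : ℝ → E →L[ℂ] E)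
    (hPsmooth : ContDiff ℝ 1 P)
    (hPsa : ∀ t, IsSelfAdjoint (P t))
    (hPproj : ∀ t, P t ∘L P t = P t)
    (Γhat : ℝ → E →L[ℂ] E)
    (hΓODE : ∀ t, HasDerivAt Γhat (deriv P t ∘L Γhat t) t)
    (hΓ0 : Γhat 0 = P 0) :
    ∀ t, P t ∘L Γhat t = Γhat t := by
  have hP : ∀ t, HasDerivAt P (deriv P t) t := fun t =>
    ((hPsmooth.differentiable (by norm_num)) t).hasDerivAt
  have hc : Continuous (deriv P) := hPsmooth.continuous_deriv (by norm_num)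
  have hPP : ∀ t, P t * P t = P t := hPproj
  have hΓ : ∀ t, HasDerivAt Γhat (deriv P t * Γhat t) t := hΓODE
  have key : ∀ t, deriv P t * P t + P t * deriv P t = deriv P t := fun t => by
    have h := (hP t).mul (hP t)
    have e : P * P = P := funext hPP
    rw [e] at h
    exact h.unique (hP t)
  intro t
  have hz := linear_ode_zero_s3 (fun t => -deriv P t) (fun t => Γhat t - P t * Γhat t) hc.neg
    (fun s => ?_) (by simp [hΓ0, hPP]) t
  · exact (sub_eq_zero.mp hz).symm
  · refine ((hΓ s).sub ((hP s).mul (hΓ s))).congr_deriv ?_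
    have h2 : P s * deriv P s = deriv P s - deriv P s * P s := eq_sub_of_add_eq' (key s)
    rw [← mul_assoc, h2]
    noncomm_ring
end

section
/- (Parallel-transport property of the holonomy operator.) Let P : ℝ → (E →L[ℂ] E) be a continuously differentiable family of orthogonal projections, and let Γ̂ : ℝ → (E →L[ℂ] E) be differentiable with Γ̂'(t) = P'(t) ∘ Γ̂(t) for all t and Γ̂(0) = P(0). Then Γ̂(t)† ∘ Γ̂'(t) = 0 for every t, where † denotes the adjoint. -/
open Matrix ContinuousLinearMap

/-- Parallel-transport property of the holonomy operator: `Γ̂(t)† ∘ Γ̂'(t) = 0`. -/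
theorem holonomy_operator_parallel_transport
    {E : Type*} [NormedAddCommGroup E] [InnerProductSpace ℂ E] [FiniteDimensional ℂ E]
    (P : ℝ → E →L[ℂ] E)
    (hPsmooth : ContDiff ℝ 1 P)
    (hPsa : ∀ t, IsSelfAdjoint (P t))
    (hPproj : ∀ t, P t ∘L P t = P t)
    (Γhat : ℝ → E →L[ℂ] E)
    (hΓODE : ∀ t, HasDerivAt Γhat (deriv P t ∘L Γhat t) t)
    (hΓ0 : Γhat 0 = P 0) :
    ∀ t, ContinuousLinearMap.adjoint (Γhat t) ∘L deriv Γhat t = 0 := by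
  have hPd : ∀ t, HasDerivAt P (deriv P t) t := fun t =>
    (hPsmooth.differentiable (by norm_num) t).hasDerivAt
  have hproj : ∀ t, P t * P t = P t := hPproj
  have hode : ∀ t, HasDerivAt Γhat (deriv P t * Γhat t) t := hΓODE
  have hcont : Continuous (deriv P) := hPsmooth.continuous_deriv (by norm_num)
  -- Leibniz rule for the projection identity
  have hL : ∀ t, deriv P t = deriv P t * P t + P t * deriv P t := by
    intro t
    have h1 := (hPd t).mul (hPd t)
    have h2 : P * P = P := funext hproj
    rw [h2] at h1
    exact (hPd t).unique h1
  -- the defect of the range condition solves a linear equation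
  have hX : ∀ t, HasDerivAt (fun t => Γhat t - P t * Γhat t)
      (-(deriv P t) * (Γhat t - P t * Γhat t)) t := by
    intro t
    have h1 := (hode t).sub ((hPd t).mul (hode t))
    refine h1.congr_deriv ?_
    have h3 : P t * (deriv P t * Γhat t) = deriv P t * Γhat t - deriv P t * (P t * Γhat t) := by
      have := congrArg (· * Γhat t) (hL t)
      simp only [add_mul, mul_assoc] at this
      rw [eq_sub_iff_add_eq, add_comm]
      exact this.symm
    rw [h3]
    noncomm_ring
  have hzero : ∀ t, Γhat t - P t * Γhat t = 0 := by
    intro t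
    obtain ⟨C, hC⟩ := (isCompact_Icc (a := -(|t| + 1)) (b := |t| + 1)).exists_bound_of_continuousOn
      hcont.continuousOn
    have key := ODE_solution_unique_of_mem_Ioo
      (v := fun s x => -(deriv P s) * x) (s := fun _ => Set.univ) (K := C.toNNReal)
      (a := -(|t| + 1)) (b := |t| + 1) (t₀ := 0)
      (f := fun t => Γhat t - P t * Γhat t) (g := fun _ => 0)
      (by
        intro s hs
        apply LipschitzWith.lipschitzOnWith
        apply LipschitzWith.of_dist_le_mul
        intro x y
        rw [dist_eq_norm, dist_eq_norm, ← mul_sub]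
        refine (norm_mul_le _ _).trans ?_
        gcongr
        rw [norm_neg]
        exact (hC s (Set.Ioo_subset_Icc_self hs)).trans (Real.le_coe_toNNReal C))
      ⟨by linarith [abs_nonneg t], by linarith [abs_nonneg t]⟩
      (fun s _ => ⟨hX s, trivial⟩)
      (fun s _ => ⟨by simpa using hasDerivAt_const s (0 : E →L[ℂ] E), trivial⟩)
      (by simp [hΓ0, hproj])
    exact key ⟨by linarith [neg_abs_le t], by linarith [le_abs_self t]⟩
  intro t
  rw [(hΓODE t).deriv]
  have hr : P t * Γhat t = Γhat t := (sub_eq_zero.mp (hzero t)).symm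
  have hPPP : P t * (deriv P t * P t) = 0 := by
    have := congrArg (fun A => P t * A * P t) (hL t)
    simp only [mul_add, add_mul, mul_assoc, hproj] at this
    rw [← mul_assoc (P t) (P t), hproj] at this
    simpa using this
  have hs : star (Γhat t) * P t = star (Γhat t) := by
    have := congrArg star hr
    rwa [star_mul, (hPsa t).star_eq] at this
  change star (Γhat t) * (deriv P t * Γhat t) = 0
  rw [← hs, ← hr, mul_assoc, ← mul_assoc (deriv P t), ← mul_assoc (P t), hr, hPPP]
  simp
end

section
/- Under the stated setup, the transformation matrix U : ℝ → Matrix (Fin ℓ) (Fin ℓ) ℂ is differentiable, satisfies U(0) = 1 (the identity matrix), and obeys the matrix differential equation U'(t) = (A(t) + K(t)) * U(t) for all t. -/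
open Matrix ContinuousLinearMap
open scoped ComplexConjugate

local notation "⟪" x ", " y "⟫" => @inner ℂ _ _ x y

/-- The transformation matrix `U` is differentiable, `U(0) = 1`, and
`U'(t) = (A(t) + K(t)) * U(t)`. -/
theorem transformation_matrix_differential_equation
    {E : Type*} [NormedAddCommGroup E] [InnerProductSpace ℂ E] [FiniteDimensional ℂ E]
    (ℓ : ℕ) (hℓ : 0 < ℓ)
    (H : ℝ → E →L[ℂ] E) (hHcont : Continuous H) (hHsa : ∀ t, IsSelfAdjoint (H t))
    (ψ : Fin ℓ → ℝ → E)
    (hψsmooth : ∀ i, ContDiff ℝ 1 (ψ i))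
    (hSchr : ∀ i t, HasDerivAt (ψ i) ((-Complex.I) • (H t) (ψ i t)) t)
    (hψON : ∀ i j t, ⟪ψ i t, ψ j t⟫ = if i = j then (1 : ℂ) else 0)
    (P : ℝ → E →L[ℂ] E) (hP : ∀ t, P t = ∑ i, ketbra (ψ i t) (ψ i t))
    (φ : Fin ℓ → ℝ → E)
    (hφsmooth : ∀ i, ContDiff ℝ 1 (φ i))
    (hφON : ∀ i j t, ⟪φ i t, φ j t⟫ = if i = j then (1 : ℂ) else 0)
    (hφspan : ∀ t, ∑ i, ketbra (φ i t) (φ i t) = P t)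
    (hφ0 : ∀ i, φ i 0 = ψ i 0)
    (A : ℝ → Matrix (Fin ℓ) (Fin ℓ) ℂ)
    (hA : ∀ t i j, A t i j = ⟪deriv (φ i) t, φ j t⟫)
    (K : ℝ → Matrix (Fin ℓ) (Fin ℓ) ℂ)
    (hK : ∀ t i j, K t i j = -Complex.I * ⟪φ i t, (H t) (φ j t)⟫)
    (U : ℝ → Matrix (Fin ℓ) (Fin ℓ) ℂ)
    (hU : ∀ t i j, U t i j = ⟪φ i t, ψ j t⟫) :
    U 0 = 1 ∧ ∀ t i j, HasDerivAt (fun s => U s i j) (((A t + K t) * U t) i j) t := by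
  have hexp : ∀ t j, ψ j t = ∑ k, U t k j • φ k t := by
    intro t j
    have h1 : P t (ψ j t) = ψ j t := by
      rw [hP]
      simp [ketbra, hψON]
    rw [← h1, ← hφspan]
    simp [ketbra, hU]
  refine ⟨?_, ?_⟩
  · ext i j
    rw [hU, hφ0, hψON, Matrix.one_apply]
  · intro t i j
    have hφd : HasDerivAt (φ i) (deriv (φ i) t) t :=
      (((hφsmooth i).differentiable (by norm_num)) t).hasDerivAt
    have h := hφd.inner ℂ (hSchr j t)
    have hfun : (fun s => U s i j) = fun s => ⟪φ i s, ψ j s⟫ := by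
      funext s
      exact hU s i j
    rw [hfun]
    suffices hval : ((A t + K t) * U t) i j =
        ⟪φ i t, (-Complex.I) • (H t) (ψ j t)⟫ + ⟪deriv (φ i) t, ψ j t⟫ by
      rw [hval]
      exact h
    rw [hexp t j, Matrix.mul_apply]
    simp only [map_sum, map_smul, inner_smul_right, inner_sum, Matrix.add_apply, hA, hK,
      Finset.mul_sum]
    rw [← Finset.sum_add_distrib]
    refine Finset.sum_congr rfl fun k _ => ?_
    ring
end

section
/- (Theorem 2: matrix separation formula for cyclic evolution.) Under the stated setup, assume the cyclicity condition φ_i(T) = φ_i(0) = ψ_i(0) for all i, for some T ∈ ℝ. Suppose Γ : ℝ → Matrix (Fin ℓ) (Fin ℓ) ℂ is differentiable with Γ'(t) = A(t) * Γ(t) and Γ(0) = 1 (the holonomic component), and D : ℝ → Matrix (Fin ℓ) (Fin ℓ) ℂ is differentiable with D'(t) = D(t) * F(t) and D(0) = 1 (the dynamical component). Then the evolution matrix after the cyclic evolution separates as U(T) = Γ(T) * D(T). -/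
open Matrix ContinuousLinearMap
open scoped ComplexConjugate

local notation "⟪" x ", " y "⟫" => @inner ℂ _ _ x y

/-- Uniqueness for the linear matrix equation with skew-Hermitian coefficients. -/
theorem skew_ode_zero {ℓ : ℕ} (A F W : ℝ → Matrix (Fin ℓ) (Fin ℓ) ℂ)
    (hA : ∀ t, (A t)ᴴ = - A t) (hF : ∀ t, (F t)ᴴ = - F t)
    (hW : ∀ t i j, HasDerivAt (fun s => W s i j) ((A t * W t + W t * F t) i j) t)
    (h0 : W 0 = 0) (t : ℝ) : W t = 0 := by
  have key : ∀ t, HasDerivAt (fun s => ((W s)ᴴ * W s).trace) 0 t := by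
    intro t
    have h1 : HasDerivAt (fun s => ∑ j, ∑ i, star (W s i j) * W s i j)
        (∑ j, ∑ i, (star ((A t * W t + W t * F t) i j) * W t i j
          + star (W t i j) * (A t * W t + W t * F t) i j)) t := by
      refine HasDerivAt.fun_sum fun j _ => HasDerivAt.fun_sum fun i _ => ?_
      exact (hW t i j).star.mul (hW t i j)
    have h2 : (∑ j, ∑ i, (star ((A t * W t + W t * F t) i j) * W t i j
          + star (W t i j) * (A t * W t + W t * F t) i j))
        = ((A t * W t + W t * F t)ᴴ * W t + (W t)ᴴ * (A t * W t + W t * F t)).trace := by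
      simp only [Matrix.trace, Matrix.diag, Matrix.add_apply (_ * W t), Matrix.mul_apply (M := _ᴴ),
        Matrix.conjTranspose_apply, Finset.sum_add_distrib]
    have h3 : ((A t * W t + W t * F t)ᴴ * W t + (W t)ᴴ * (A t * W t + W t * F t)).trace = 0 := by
      have : (A t * W t + W t * F t)ᴴ * W t + (W t)ᴴ * (A t * W t + W t * F t)
          = (W t)ᴴ * W t * F t - F t * ((W t)ᴴ * W t) := by
        rw [Matrix.conjTranspose_add, Matrix.conjTranspose_mul, Matrix.conjTranspose_mul, hA, hF]
        noncomm_ring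
      rw [this, Matrix.trace_sub, Matrix.trace_mul_comm, sub_self]
    rw [h2, h3] at h1
    exact h1
  have hc := is_const_of_deriv_eq_zero (fun t => (key t).differentiableAt)
    (fun t => (key t).deriv) t 0
  simp only [h0, Matrix.mul_zero, Matrix.trace_zero] at hc
  open scoped ComplexOrder in
  exact Matrix.trace_conjTranspose_mul_self_eq_zero_iff.mp hc

/-- Orthonormal frames have skew-Hermitian connection. -/
theorem frame_skew {E : Type*} [NormedAddCommGroup E] [InnerProductSpace ℂ E] {ℓ : ℕ}
    (φ φd : Fin ℓ → ℝ → E) (hd : ∀ i t, HasDerivAt (φ i) (φd i t) t)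
    (hON : ∀ i j t, ⟪φ i t, φ j t⟫ = if i = j then (1 : ℂ) else 0) (i j : Fin ℓ) (t : ℝ) :
    ⟪φ i t, φd j t⟫ + ⟪φd i t, φ j t⟫ = 0 := by
  have h := (hd i t).inner ℂ (hd j t)
  have h2 : (fun s => ⟪φ i s, φ j s⟫) = fun _ => if i = j then (1 : ℂ) else 0 :=
    funext fun s => hON i j s
  rw [h2] at h
  exact h.unique (hasDerivAt_const t _)

/-- Theorem 2: matrix separation formula for cyclic evolution, `U(T) = Γ(T) * D(T)`. -/
theorem matrix_separation_cyclic_evolution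
    {E : Type*} [NormedAddCommGroup E] [InnerProductSpace ℂ E] [FiniteDimensional ℂ E]
    (ℓ : ℕ) (hℓ : 0 < ℓ)
    (H : ℝ → E →L[ℂ] E) (hHcont : Continuous H) (hHsa : ∀ t, IsSelfAdjoint (H t))
    (ψ : Fin ℓ → ℝ → E)
    (hψsmooth : ∀ i, ContDiff ℝ 1 (ψ i))
    (hSchr : ∀ i t, HasDerivAt (ψ i) ((-Complex.I) • (H t) (ψ i t)) t)
    (hψON : ∀ i j t, ⟪ψ i t, ψ j t⟫ = if i = j then (1 : ℂ) else 0)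
    (P : ℝ → E →L[ℂ] E) (hP : ∀ t, P t = ∑ i, ketbra (ψ i t) (ψ i t))
    (F : ℝ → Matrix (Fin ℓ) (Fin ℓ) ℂ)
    (hF : ∀ t i j, F t i j = -Complex.I * ⟪ψ i t, (H t) (ψ j t)⟫)
    (φ : Fin ℓ → ℝ → E)
    (hφsmooth : ∀ i, ContDiff ℝ 1 (φ i))
    (hφON : ∀ i j t, ⟪φ i t, φ j t⟫ = if i = j then (1 : ℂ) else 0)
    (hφspan : ∀ t, ∑ i, ketbra (φ i t) (φ i t) = P t)
    (hφ0 : ∀ i, φ i 0 = ψ i 0)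
    (A : ℝ → Matrix (Fin ℓ) (Fin ℓ) ℂ)
    (hA : ∀ t i j, A t i j = ⟪deriv (φ i) t, φ j t⟫)
    (U : ℝ → Matrix (Fin ℓ) (Fin ℓ) ℂ)
    (hU : ∀ t i j, U t i j = ⟪φ i t, ψ j t⟫)
    (T : ℝ) (hcyc : ∀ i, φ i T = φ i 0)
    (Γ : ℝ → Matrix (Fin ℓ) (Fin ℓ) ℂ)
    (hΓODE : ∀ t i j, HasDerivAt (fun s => Γ s i j) ((A t * Γ t) i j) t)
    (hΓ0 : Γ 0 = 1)
    (D : ℝ → Matrix (Fin ℓ) (Fin ℓ) ℂ)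
    (hDODE : ∀ t i j, HasDerivAt (fun s => D s i j) ((D t * F t) i j) t)
    (hD0 : D 0 = 1) :
    U T = Γ T * D T := by
  have hφd : ∀ i t, HasDerivAt (φ i) (deriv (φ i) t) t := fun i t =>
    (((hφsmooth i).differentiable (by norm_num)) t).hasDerivAt
  have hAs : ∀ t, (A t)ᴴ = - A t := by
    intro t
    ext i j
    have h := frame_skew φ (fun i => deriv (φ i)) hφd hφON i j t
    rw [Matrix.conjTranspose_apply, Matrix.neg_apply, hA, hA, ← starRingEnd_apply, inner_conj_symm]
    exact eq_neg_of_add_eq_zero_left h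
  have hFs : ∀ t, (F t)ᴴ = - F t := by
    intro t
    ext i j
    have hsk := frame_skew ψ (fun i t => (-Complex.I) • (H t) (ψ i t)) hSchr hψON i j t
    rw [Matrix.conjTranspose_apply, Matrix.neg_apply, hF, hF, ← inner_smul_right,
      ← inner_smul_right, ← starRingEnd_apply, inner_conj_symm]
    exact eq_neg_of_add_eq_zero_right hsk
  have e1 : ∀ t (z w : E), ⟪z, P t w⟫ = ∑ k, ⟪z, φ k t⟫ * ⟪φ k t, w⟫ := by
    intro t z w
    rw [← hφspan]
    simp [ketbra, mul_comm]
  have e2 : ∀ t (z w : E), ⟪z, P t w⟫ = ∑ k, ⟪z, ψ k t⟫ * ⟪ψ k t, w⟫ := by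
    intro t z w
    rw [hP]
    simp [ketbra, mul_comm]
  have p1 : ∀ t (z : E) j, ⟪z, P t (ψ j t)⟫ = ⟪z, ψ j t⟫ := by
    intro t z j
    rw [e2]
    simp [hψON]
  have p2 : ∀ t (z : E) i, ⟪φ i t, P t z⟫ = ⟪φ i t, z⟫ := by
    intro t z i
    rw [e1]
    simp [hφON]
  have hUd : ∀ t i j, HasDerivAt (fun s => U s i j) ((A t * U t + U t * F t) i j) t := by
    intro t i j
    have h := (hφd i t).inner ℂ (hSchr j t)
    have hfun : (fun s => U s i j) = fun s => ⟪φ i s, ψ j s⟫ := funext fun s => hU s i j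
    rw [hfun]
    refine HasDerivAt.congr_deriv h (Eq.symm ?_)
    rw [Matrix.add_apply, Matrix.mul_apply, Matrix.mul_apply, add_comm, ← p1 t (deriv (φ i) t) j,
      e1, ← p2, e2]
    simp only [hU, hF, hA, inner_smul_right]
  have hW := skew_ode_zero A F (fun t => U t - Γ t * D t) hAs hFs (by
    intro t i j
    have hg : HasDerivAt (fun s => ∑ k, Γ s i k * D s k j)
        (∑ k, ((A t * Γ t) i k * D t k j + Γ t i k * (D t * F t) k j)) t :=
      HasDerivAt.fun_sum fun k _ => (hΓODE t i k).mul (hDODE t k j)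
    have h := (hUd t i j).sub hg
    have e : A t * (U t - Γ t * D t) + (U t - Γ t * D t) * F t
        = (A t * U t + U t * F t) - ((A t * Γ t) * D t + Γ t * (D t * F t)) := by
      noncomm_ring
    rw [e, Matrix.sub_apply, Matrix.add_apply (A t * Γ t * D t), Matrix.mul_apply (M := A t * Γ t),
      Matrix.mul_apply (M := Γ t), ← Finset.sum_add_distrib]
    exact h) (by
    have : U 0 = 1 := by
      ext i j
      rw [hU, hφ0, hψON, Matrix.one_apply]
    simp [this, hΓ0, hD0]) T
  exact sub_eq_zero.mp hW
end

section
/- (Corollary 1: criterion for purely holonomic evolution.) Under the stated setup, assume the cyclicity condition φ_i(T) = φ_i(0) = ψ_i(0) for all i, for some T ∈ ℝ, let Γ : ℝ → Matrix (Fin ℓ) (Fin ℓ) ℂ be differentiable with Γ'(t) = A(t) * Γ(t) and Γ(0) = 1, and let D : ℝ → Matrix (Fin ℓ) (Fin ℓ) ℂ be differentiable with D'(t) = D(t) * F(t) and D(0) = 1. Then the evolution is purely holonomic, i.e. there exists a real number α with U(T) = exp(i α) • Γ(T), if and only if there exists a real number β with D(T) = exp(i β) • 1. -/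
open Matrix ContinuousLinearMap
open scoped ComplexConjugate

local notation "⟪" x ", " y "⟫" => @inner ℂ _ _ x y

lemma md_mul {n : ℕ} {M N : ℝ → Matrix (Fin n) (Fin n) ℂ} {M' N' : Matrix (Fin n) (Fin n) ℂ}
    {t : ℝ} (hM : ∀ i j, HasDerivAt (fun s => M s i j) (M' i j) t)
    (hN : ∀ i j, HasDerivAt (fun s => N s i j) (N' i j) t) :
    ∀ i j, HasDerivAt (fun s => (M s * N s) i j) ((M' * N t + M t * N') i j) t := by
  intro i j
  simp only [Matrix.mul_apply, Matrix.add_apply, ← Finset.sum_add_distrib]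
  exact HasDerivAt.fun_sum fun k _ => (hM i k).mul (hN k j)

lemma md_star {n : ℕ} {M : ℝ → Matrix (Fin n) (Fin n) ℂ} {M' : Matrix (Fin n) (Fin n) ℂ}
    {t : ℝ} (hM : ∀ i j, HasDerivAt (fun s => M s i j) (M' i j) t) :
    ∀ i j, HasDerivAt (fun s => (M s)ᴴ i j) (M'ᴴ i j) t := by
  intro i j
  simp only [Matrix.conjTranspose_apply]
  exact (hM j i).star

lemma md_const {n : ℕ} {M : ℝ → Matrix (Fin n) (Fin n) ℂ}
    (hM : ∀ t i j, HasDerivAt (fun s => M s i j) 0 t) (t : ℝ) : M t = M 0 := by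
  ext i j
  exact is_const_of_deriv_eq_zero (f := fun s => M s i j)
    (fun s => (hM s i j).differentiableAt) (fun s => (hM s i j).deriv) t 0

lemma sum_ketbra_apply {E : Type*} [NormedAddCommGroup E] [InnerProductSpace ℂ E] {n : ℕ}
    (v : Fin n → E) (z : E) :
    (∑ i, ketbra (v i) (v i)) z = ∑ i, ⟪v i, z⟫ • v i := by
  simp [ketbra]

/-- Corollary 1: the cyclic evolution is purely holonomic, i.e. `U(T) = e^{iα} Γ(T)`
for some real `α`, if and only if the dynamical component satisfies
`D(T) = e^{iβ} 1` for some real `β`. -/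
theorem purely_holonomic_iff
    {E : Type*} [NormedAddCommGroup E] [InnerProductSpace ℂ E] [FiniteDimensional ℂ E]
    (ℓ : ℕ) (hℓ : 0 < ℓ)
    (H : ℝ → E →L[ℂ] E) (hHcont : Continuous H) (hHsa : ∀ t, IsSelfAdjoint (H t))
    (ψ : Fin ℓ → ℝ → E)
    (hψsmooth : ∀ i, ContDiff ℝ 1 (ψ i))
    (hSchr : ∀ i t, HasDerivAt (ψ i) ((-Complex.I) • (H t) (ψ i t)) t)
    (hψON : ∀ i j t, ⟪ψ i t, ψ j t⟫ = if i = j then (1 : ℂ) else 0)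
    (P : ℝ → E →L[ℂ] E) (hP : ∀ t, P t = ∑ i, ketbra (ψ i t) (ψ i t))
    (F : ℝ → Matrix (Fin ℓ) (Fin ℓ) ℂ)
    (hF : ∀ t i j, F t i j = -Complex.I * ⟪ψ i t, (H t) (ψ j t)⟫)
    (φ : Fin ℓ → ℝ → E)
    (hφsmooth : ∀ i, ContDiff ℝ 1 (φ i))
    (hφON : ∀ i j t, ⟪φ i t, φ j t⟫ = if i = j then (1 : ℂ) else 0)
    (hφspan : ∀ t, ∑ i, ketbra (φ i t) (φ i t) = P t)
    (hφ0 : ∀ i, φ i 0 = ψ i 0)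
    (A : ℝ → Matrix (Fin ℓ) (Fin ℓ) ℂ)
    (hA : ∀ t i j, A t i j = ⟪deriv (φ i) t, φ j t⟫)
    (U : ℝ → Matrix (Fin ℓ) (Fin ℓ) ℂ)
    (hU : ∀ t i j, U t i j = ⟪φ i t, ψ j t⟫)
    (T : ℝ) (hcyc : ∀ i, φ i T = φ i 0)
    (Γ : ℝ → Matrix (Fin ℓ) (Fin ℓ) ℂ)
    (hΓODE : ∀ t i j, HasDerivAt (fun s => Γ s i j) ((A t * Γ t) i j) t)
    (hΓ0 : Γ 0 = 1)
    (D : ℝ → Matrix (Fin ℓ) (Fin ℓ) ℂ)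
    (hDODE : ∀ t i j, HasDerivAt (fun s => D s i j) ((D t * F t) i j) t)
    (hD0 : D 0 = 1) :
    (∃ α : ℝ, U T = Complex.exp (Complex.I * α) • Γ T) ↔
      (∃ β : ℝ, D T = Complex.exp (Complex.I * β) • (1 : Matrix (Fin ℓ) (Fin ℓ) ℂ)) := by
  have hφd : ∀ i t, HasDerivAt (φ i) (deriv (φ i) t) t := fun i t =>
    (((hφsmooth i).differentiable (by norm_num)) t).hasDerivAt
  have hAah : ∀ t, (A t)ᴴ = -A t := by
    intro t
    ext i j
    have h1 := (hφd i t).inner ℂ (hφd j t)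
    have h2 : HasDerivAt (fun s => ⟪φ i s, φ j s⟫) 0 t := by
      simp only [hφON]
      exact hasDerivAt_const _ _
    have h3 := h1.unique h2
    rw [Matrix.conjTranspose_apply, Matrix.neg_apply, hA, hA, ← starRingEnd_apply,
      inner_conj_symm]
    linear_combination h3
  have hFah : ∀ t, (F t)ᴴ = -F t := by
    intro t
    ext i j
    have hs : ⟪H t (ψ i t), ψ j t⟫ = ⟪ψ i t, H t (ψ j t)⟫ :=
      (hHsa t).isSymmetric (ψ i t) (ψ j t)
    rw [Matrix.conjTranspose_apply, Matrix.neg_apply, hF, hF, ← starRingEnd_apply, map_mul,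
      inner_conj_symm, hs]
    simp
  have hψexp : ∀ j t, ψ j t = ∑ k, ⟪φ k t, ψ j t⟫ • φ k t := by
    intro j t
    have h : (∑ i, ketbra (φ i t) (φ i t)) (ψ j t) = (∑ i, ketbra (ψ i t) (ψ i t)) (ψ j t) := by
      rw [hφspan, hP]
    rw [sum_ketbra_apply (fun i => φ i t), sum_ketbra_apply (fun i => ψ i t)] at h
    simpa [hψON] using h.symm
  have hφexp : ∀ j t, φ j t = ∑ k, ⟪ψ k t, φ j t⟫ • ψ k t := by
    intro j t
    have h : (∑ i, ketbra (φ i t) (φ i t)) (φ j t) = (∑ i, ketbra (ψ i t) (ψ i t)) (φ j t) := by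
      rw [hφspan, hP]
    rw [sum_ketbra_apply (fun i => φ i t), sum_ketbra_apply (fun i => ψ i t)] at h
    simpa [hφON] using h
  have hUODE : ∀ t i j, HasDerivAt (fun s => U s i j) ((A t * U t + U t * F t) i j) t := by
    intro t i j
    simp only [hU]
    have h1 := (hφd i t).inner ℂ (hSchr j t)
    refine HasDerivAt.congr_deriv h1 (Eq.symm ?_)
    rw [Matrix.add_apply, Matrix.mul_apply, Matrix.mul_apply, add_comm]
    congr 1
    · conv_rhs => rw [hφexp i t]
      rw [sum_inner]
      refine Finset.sum_congr rfl fun k _ => ?_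
      rw [inner_smul_left, inner_smul_right, inner_conj_symm, hU, hF]
    · conv_rhs => rw [hψexp j t]
      rw [inner_sum]
      refine Finset.sum_congr rfl fun k _ => ?_
      rw [inner_smul_right, hU, hA, mul_comm]
  have hU0 : U 0 = 1 := by
    ext i j
    rw [hU, hφ0, hψON, Matrix.one_apply]
  have hΓu : ∀ t, (Γ t)ᴴ * Γ t = 1 := by
    intro t
    have := md_const (M := fun t => (Γ t)ᴴ * Γ t) (fun t i j => by
      have h := md_mul (md_star (hΓODE t)) (hΓODE t) i j
      convert h using 1
      rw [Matrix.conjTranspose_mul, hAah]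
      simp [Matrix.mul_assoc]) t
    simpa [hΓ0] using this
  have hDu : ∀ t, D t * (D t)ᴴ = 1 := by
    intro t
    have := md_const (M := fun t => D t * (D t)ᴴ) (fun t i j => by
      have h := md_mul (hDODE t) (md_star (hDODE t)) i j
      convert h using 1
      rw [Matrix.conjTranspose_mul, hFah]
      simp [Matrix.mul_assoc]) t
    simpa [hD0] using this
  have hW : ∀ t, (Γ t)ᴴ * U t * (D t)ᴴ = 1 := by
    intro t
    have := md_const (M := fun t => (Γ t)ᴴ * U t * (D t)ᴴ) (fun t i j => by
      have h := md_mul (md_mul (md_star (hΓODE t)) (hUODE t)) (md_star (hDODE t)) i j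
      convert h using 1
      rw [Matrix.conjTranspose_mul, Matrix.conjTranspose_mul, hFah, hAah]
      have : ((Γ t)ᴴ * -A t * U t + (Γ t)ᴴ * (A t * U t + U t * F t)) * (D t)ᴴ
        + (Γ t)ᴴ * U t * (-F t * (D t)ᴴ) = 0 := by noncomm_ring
      rw [this]
      rfl) t
    simpa [hΓ0, hU0, hD0] using this
  have hΓu' : Γ T * (Γ T)ᴴ = 1 := mul_eq_one_comm.mp (hΓu T)
  have hDu' : (D T)ᴴ * D T = 1 := mul_eq_one_comm.mp (hDu T)
  have hUT : U T = Γ T * D T := by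
    calc U T = (Γ T * (Γ T)ᴴ) * U T * ((D T)ᴴ * D T) := by rw [hΓu', hDu']; simp
      _ = Γ T * ((Γ T)ᴴ * U T * (D T)ᴴ) * D T := by simp only [Matrix.mul_assoc]
      _ = Γ T * D T := by rw [hW]; simp
  refine exists_congr fun α => ⟨fun h => ?_, fun h => ?_⟩
  · calc D T = (Γ T)ᴴ * U T := by rw [hUT, ← Matrix.mul_assoc, hΓu, Matrix.one_mul]
      _ = _ := by rw [h, Matrix.mul_smul, hΓu]
  · rw [hUT, h, Matrix.mul_smul, Matrix.mul_one]
end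

section
/- (Adiabatic reduction: Berry/Wilczek–Zee form.) Under the stated setup, assume the cyclicity condition φ_i(T) = φ_i(0) = ψ_i(0) for all i, for some T ∈ ℝ, let Γ : ℝ → Matrix (Fin ℓ) (Fin ℓ) ℂ be differentiable with Γ'(t) = A(t) * Γ(t) and Γ(0) = 1, and assume additionally that there is a continuous function 𝐄 : ℝ → ℝ with ⟪ψ_i(t), H(t) ψ_j(t)⟫ = 𝐄(t) • δ_ij for all i, j, t (i.e. F(t) = -i 𝐄(t) • 1). Then U(T) = exp(-i ∫₀ᵀ 𝐄(t) dt) • Γ(T). -/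
open Matrix ContinuousLinearMap
open scoped ComplexConjugate

local notation "⟪" x ", " y "⟫" => @inner ℂ _ _ x y

/-- Uniqueness for a linear ODE with skew-Hermitian generator. -/
theorem skew_ode_zero_s12 {n : ℕ} (B : ℝ → Fin n → Fin n → ℂ)
    (hB : ∀ t i k, conj (B t i k) = - B t k i)
    (w : Fin n → ℝ → ℂ)
    (hw : ∀ i t, HasDerivAt (w i) (∑ k, B t i k * w k t) t)
    (h0 : ∀ i, w i 0 = 0) (i : Fin n) (t : ℝ) : w i t = 0 := by
  have hd : ∀ s, HasDerivAt (fun s => ∑ i, conj (w i s) * w i s) 0 s := by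
    intro s
    have h1 : ∀ i ∈ (Finset.univ : Finset (Fin n)),
        HasDerivAt (fun s => conj (w i s) * w i s)
          (conj (∑ k, B s i k * w k s) * w i s + conj (w i s) * (∑ k, B s i k * w k s)) s := by
      intro i _
      exact (HasDerivAt.star (hw i s)).mul (hw i s)
    have h2 := HasDerivAt.fun_sum h1
    refine HasDerivAt.congr_deriv h2 ?_
    rw [Finset.sum_add_distrib]
    simp only [map_sum, map_mul, Finset.sum_mul, Finset.mul_sum, hB]
    rw [Finset.sum_comm, ← Finset.sum_add_distrib]
    apply Finset.sum_eq_zero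
    intro a _
    rw [← Finset.sum_add_distrib]
    apply Finset.sum_eq_zero
    intro b _
    ring
  have hc := is_const_of_deriv_eq_zero (fun s => (hd s).differentiableAt)
    (fun s => (hd s).deriv) t 0
  simp only [h0, mul_zero, Finset.sum_const_zero] at hc
  have hr : ∑ i, Complex.normSq (w i t) = 0 := by
    have : ((∑ i, Complex.normSq (w i t) : ℝ) : ℂ) = 0 := by
      rw [← hc]
      push_cast
      exact Finset.sum_congr rfl fun i _ => Complex.normSq_eq_conj_mul_self
    exact_mod_cast this
  rw [Finset.sum_eq_zero_iff_of_nonneg (fun i _ => Complex.normSq_nonneg _)] at hr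
  exact Complex.normSq_eq_zero.1 (hr i (Finset.mem_univ i))

/-- Adiabatic reduction (Berry/Wilczek–Zee form): if `F(t) = -i E(t) • 1`, then
`U(T) = exp(-i ∫₀ᵀ E(t) dt) • Γ(T)`. -/
theorem berry_wilczek_zee_reduction
    {E : Type*} [NormedAddCommGroup E] [InnerProductSpace ℂ E] [FiniteDimensional ℂ E]
    (ℓ : ℕ) (hℓ : 0 < ℓ)
    (H : ℝ → E →L[ℂ] E) (hHcont : Continuous H) (hHsa : ∀ t, IsSelfAdjoint (H t))
    (ψ : Fin ℓ → ℝ → E)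
    (hψsmooth : ∀ i, ContDiff ℝ 1 (ψ i))
    (hSchr : ∀ i t, HasDerivAt (ψ i) ((-Complex.I) • (H t) (ψ i t)) t)
    (hψON : ∀ i j t, ⟪ψ i t, ψ j t⟫ = if i = j then (1 : ℂ) else 0)
    (P : ℝ → E →L[ℂ] E) (hP : ∀ t, P t = ∑ i, ketbra (ψ i t) (ψ i t))
    (φ : Fin ℓ → ℝ → E)
    (hφsmooth : ∀ i, ContDiff ℝ 1 (φ i))
    (hφON : ∀ i j t, ⟪φ i t, φ j t⟫ = if i = j then (1 : ℂ) else 0)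
    (hφspan : ∀ t, ∑ i, ketbra (φ i t) (φ i t) = P t)
    (hφ0 : ∀ i, φ i 0 = ψ i 0)
    (A : ℝ → Matrix (Fin ℓ) (Fin ℓ) ℂ)
    (hA : ∀ t i j, A t i j = ⟪deriv (φ i) t, φ j t⟫)
    (U : ℝ → Matrix (Fin ℓ) (Fin ℓ) ℂ)
    (hU : ∀ t i j, U t i j = ⟪φ i t, ψ j t⟫)
    (T : ℝ) (hcyc : ∀ i, φ i T = φ i 0)
    (Γ : ℝ → Matrix (Fin ℓ) (Fin ℓ) ℂ)
    (hΓODE : ∀ t i j, HasDerivAt (fun s => Γ s i j) ((A t * Γ t) i j) t)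
    (hΓ0 : Γ 0 = 1)
    (𝓔 : ℝ → ℝ) (h𝓔cont : Continuous 𝓔)
    (h𝓔 : ∀ i j t, ⟪ψ i t, (H t) (ψ j t)⟫ = if i = j then ((𝓔 t : ℂ)) else 0) :
    U T = Complex.exp (-Complex.I * ((∫ t in (0:ℝ)..T, 𝓔 t : ℝ) : ℂ)) • Γ T := by
  have hφd : ∀ i t, HasDerivAt (φ i) (deriv (φ i) t) t := fun i t =>
    ((hφsmooth i).differentiable one_ne_zero t).hasDerivAt
  have hAskew : ∀ t i k, conj (A t i k) = - A t k i := by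
    intro t i k
    have h1 := (hφd k t).inner ℂ (hφd i t)
    have h2 : HasDerivAt (fun s => ⟪φ k s, φ i s⟫) 0 t := by
      simp only [hφON]
      exact hasDerivAt_const _ _
    have h3 := h1.unique h2
    rw [hA, hA, inner_conj_symm]
    exact eq_neg_of_add_eq_zero_left h3
  have hPψ : ∀ t j, P t (ψ j t) = ψ j t := by
    intro t j
    simp [hP, ketbra, hψON]
  have hPφ : ∀ t j, P t (φ j t) = φ j t := by
    intro t j
    simp [← hφspan, ketbra, hφON]
  have hψe : ∀ t j, ∑ k, ⟪φ k t, ψ j t⟫ • φ k t = ψ j t := by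
    intro t j
    have := hPψ t j
    rw [← hφspan] at this
    simpa [ketbra] using this
  have hφe : ∀ t j, ∑ k, ⟪ψ k t, φ j t⟫ • ψ k t = φ j t := by
    intro t j
    have := hPφ t j
    rw [hP] at this
    simpa [ketbra] using this
  have hterm : ∀ t i j, ⟪deriv (φ i) t, ψ j t⟫ = ∑ k, A t i k * U t k j := by
    intro t i j
    conv_lhs => rw [← hψe t j]
    rw [inner_sum]
    refine Finset.sum_congr rfl fun k _ => ?_
    rw [inner_smul_right, hA, hU, mul_comm]
  have hHterm : ∀ t i j, ⟪φ i t, H t (ψ j t)⟫ = 𝓔 t * U t i j := by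
    intro t i j
    conv_lhs => rw [← hφe t i]
    rw [sum_inner]
    simp only [inner_smul_left, inner_conj_symm, h𝓔, hU]
    simp [mul_comm]
  have hUd : ∀ i j t, HasDerivAt (fun s => U s i j)
      (∑ k, A t i k * U t k j + -Complex.I * 𝓔 t * U t i j) t := by
    intro i j t
    have h1 := (hφd i t).inner ℂ (hSchr j t)
    simp only [← hU] at h1
    refine HasDerivAt.congr_deriv h1 ?_
    rw [hterm, inner_smul_right, hHterm]
    ring
  have hed : ∀ t, HasDerivAt
      (fun s => Complex.exp (-Complex.I * ((∫ t in (0:ℝ)..s, 𝓔 t : ℝ) : ℂ)))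
      (Complex.exp (-Complex.I * ((∫ t in (0:ℝ)..t, 𝓔 t : ℝ) : ℂ)) * (-Complex.I * 𝓔 t)) t := by
    intro t
    have h1 : HasDerivAt (fun s => ∫ t in (0:ℝ)..s, 𝓔 t) (𝓔 t) t :=
      intervalIntegral.integral_hasDerivAt_right (h𝓔cont.intervalIntegrable _ _)
        h𝓔cont.stronglyMeasurable.stronglyMeasurableAtFilter h𝓔cont.continuousAt
    exact (h1.ofReal_comp.const_mul (-Complex.I)).cexp
  ext i j
  rw [Matrix.smul_apply, smul_eq_mul, ← sub_eq_zero]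
  refine skew_ode_zero_s12 (fun t i k => A t i k + if i = k then -Complex.I * 𝓔 t else 0) ?_
    (fun i s => U s i j - Complex.exp (-Complex.I * ((∫ t in (0:ℝ)..s, 𝓔 t : ℝ) : ℂ)) * Γ s i j)
    ?_ ?_ i T
  · intro t i k
    rw [map_add, hAskew]
    by_cases h : i = k
    · subst h
      simp
      ring
    · simp [h, Ne.symm h]
  · intro i t
    refine HasDerivAt.congr_deriv ((hUd i j t).sub ((hed t).mul (hΓODE t i j))) ?_
    simp only [add_mul, Finset.sum_add_distrib, mul_sub, Finset.sum_sub_distrib, ite_mul,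
      zero_mul, Finset.sum_ite_eq, Finset.mem_univ, if_true, Matrix.mul_apply, Finset.mul_sum]
    simp only [mul_left_comm (A t i _)]
    ring
  · intro i
    simp [hU, hφ0, hΓ0, hψON, Matrix.one_apply]
end

section
/- (Abelian reduction: Aharonov–Anandan phase.) Let H : ℝ → (E →L[ℂ] E) be a continuous family of self-adjoint operators, let ψ : ℝ → E be continuously differentiable with ψ'(t) = -i • H(t) (ψ(t)) and ‖ψ(t)‖ = 1 for all t, and let φ : ℝ → E be continuously differentiable with ‖φ(t)‖ = 1 for all t and φ(T) = φ(0) = ψ(0) for some T ∈ ℝ. Let u : ℝ → ℂ be defined by u(t) = ⟪φ(t), ψ(t)⟫ and assume ψ(t) = u(t) • φ(t) for all t. Then u(T) = exp(∫₀ᵀ ⟪φ'(t), φ(t)⟫ dt) * exp(-i ∫₀ᵀ ⟪ψ(t), H(t) ψ(t)⟫ dt), where the first factor is the holonomic (geometric) component and the second the dynamical component. -/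
open ContinuousLinearMap
open scoped ComplexConjugate

local notation "⟪" x ", " y "⟫" => @inner ℂ _ _ x y

/-- Abelian reduction: the Aharonov–Anandan separation of the total phase into the
geometric (holonomic) and dynamical components,
`u(T) = exp(∫₀ᵀ ⟪φ', φ⟫) * exp(-i ∫₀ᵀ ⟪ψ, H ψ⟫)`. -/
theorem aharonov_anandan_phase
    {E : Type*} [NormedAddCommGroup E] [InnerProductSpace ℂ E] [FiniteDimensional ℂ E]
    (H : ℝ → E →L[ℂ] E) (hHcont : Continuous H) (hHsa : ∀ t, IsSelfAdjoint (H t))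
    (ψ : ℝ → E) (hψsmooth : ContDiff ℝ 1 ψ)
    (hSchr : ∀ t, HasDerivAt ψ ((-Complex.I) • (H t) (ψ t)) t)
    (hψnorm : ∀ t, ‖ψ t‖ = 1)
    (φ : ℝ → E) (hφsmooth : ContDiff ℝ 1 φ)
    (hφnorm : ∀ t, ‖φ t‖ = 1)
    (T : ℝ) (hcyc : φ T = φ 0) (hφ0 : φ 0 = ψ 0)
    (u : ℝ → ℂ) (hu : ∀ t, u t = ⟪φ t, ψ t⟫)
    (hψφ : ∀ t, ψ t = u t • φ t) :
    u T = Complex.exp (∫ t in (0:ℝ)..T, ⟪deriv φ t, φ t⟫) *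
      Complex.exp (-Complex.I * ∫ t in (0:ℝ)..T, ⟪ψ t, (H t) (ψ t)⟫) := by
  have hφc : Continuous φ := hφsmooth.continuous
  have hψc : Continuous ψ := hψsmooth.continuous
  have hdφ : Continuous (deriv φ) := hφsmooth.continuous_deriv le_rfl
  have hφd : ∀ t, HasDerivAt φ (deriv φ t) t := fun t =>
    (hφsmooth.differentiable one_ne_zero t).hasDerivAt
  have ha : Continuous (fun t => ⟪deriv φ t, φ t⟫) := hdφ.inner hφc
  have hb : Continuous (fun t => ⟪ψ t, (H t) (ψ t)⟫) := hψc.inner (hHcont.clm_apply hψc)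
  have hun : ∀ t, u t * conj (u t) = 1 := by
    intro t
    have h1 : ‖u t‖ = 1 := by
      have h := hψnorm t
      rw [hψφ t, norm_smul, hφnorm t, mul_one] at h
      exact h
    rw [Complex.mul_conj, Complex.normSq_eq_norm_sq, h1]
    norm_num
  have hud : ∀ t, HasDerivAt u
      ((⟪deriv φ t, φ t⟫ + -Complex.I * ⟪ψ t, (H t) (ψ t)⟫) * u t) t := by
    intro t
    have h := (hφd t).inner ℂ (hSchr t)
    have hfun : u = fun t => ⟪φ t, ψ t⟫ := funext hu
    have e1 : ⟪deriv φ t, ψ t⟫ = u t * ⟪deriv φ t, φ t⟫ := by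
      conv_lhs => rw [hψφ t]
      rw [inner_smul_right]
    have e2 : ⟪ψ t, (H t) (ψ t)⟫ = conj (u t) * ⟪φ t, (H t) (ψ t)⟫ := by
      have : ∀ w : E, ⟪ψ t, w⟫ = conj (u t) * ⟪φ t, w⟫ := by
        intro w
        rw [hψφ t, inner_smul_left]
      exact this _
    have h2 : HasDerivAt u (⟪φ t, (-Complex.I) • (H t) (ψ t)⟫ + ⟪deriv φ t, ψ t⟫) t := by
      rw [hfun]; exact h
    convert h2 using 1
    rw [inner_smul_right, e1, e2]
    linear_combination (-Complex.I * ⟪φ t, (H t) (ψ t)⟫) * hun t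
  have hA : ∀ t, HasDerivAt (fun s => ∫ x in (0:ℝ)..s, ⟪deriv φ x, φ x⟫)
      ⟪deriv φ t, φ t⟫ t := fun t => ha.integral_hasStrictDerivAt 0 t |>.hasDerivAt
  have hB : ∀ t, HasDerivAt (fun s => ∫ x in (0:ℝ)..s, ⟪ψ x, (H x) (ψ x)⟫)
      ⟪ψ t, (H t) (ψ t)⟫ t := fun t => hb.integral_hasStrictDerivAt 0 t |>.hasDerivAt
  have hg : ∀ t, HasDerivAt (fun s => u s * Complex.exp
      (-((∫ x in (0:ℝ)..s, ⟪deriv φ x, φ x⟫) +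
        -Complex.I * ∫ x in (0:ℝ)..s, ⟪ψ x, (H x) (ψ x)⟫))) 0 t := by
    intro t
    have h := (hud t).mul ((((hA t).add ((hB t).const_mul (-Complex.I))).neg).cexp)
    refine h.congr_deriv ?_
    simp only [Pi.add_apply, Pi.neg_apply]
    ring
  have hconst := is_const_of_deriv_eq_zero (fun t => (hg t).differentiableAt)
    (fun t => (hg t).deriv) T 0
  have hu0 : u 0 = 1 := by
    rw [hu, hφ0, inner_self_eq_norm_sq_to_K, hψnorm]
    norm_num
  simp only [intervalIntegral.integral_same, hu0, mul_zero, add_zero, neg_zero,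
    Complex.exp_zero, mul_one] at hconst
  rw [← Complex.exp_add]
  rw [Complex.exp_neg] at hconst
  exact (mul_inv_eq_one₀ (Complex.exp_ne_zero _)).mp hconst
end

section
/- (Purely holonomic evolution in the one-parameter example.) Let v0, v1, v2 be orthonormal vectors in E, let E1, E2 : ℝ with E1 ≠ E2, let a1, a2 : ℂ with |a1|² + |a2|² = 1, let ω : ℝ → ℝ be continuous, and set θ(t) = ∫₀ᵗ ω(s) ds. Define the Hamiltonian H(t) = ω(t) • (E1 • |v1⟩⟨v1| + E2 • |v2⟩⟨v2|) and the curves ψ1(t) = v0 and ψ2(t) = (conj(a2) * exp(-i E1 θ(t))) • v1 - (conj(a1) * exp(-i E2 θ(t))) • v2 (which solve the Schrödinger equation ψ_i'(t) = -i • H(t)(ψ_i(t)) and are orthonormal at every t). Define the 2×2 complex matrix F(t) with entries F_ij(t) = -i ⟪ψ_i(t), H(t) ψ_j(t)⟫. Suppose T ∈ ℝ and there exist integers N ≠ 0 and m with (E2 - E1) * θ(T) = 2 π N and |a1|² = m / N - E1 / (E2 - E1). Then: (a) ψ1(T) = ψ1(0) and ψ2(T) = exp(-2 π i N E1 / (E2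 - E1)) • ψ2(0); and (b) every differentiable D : ℝ → Matrix (Fin 2) (Fin 2) ℂ with D'(t) = D(t) * F(t) for all t and D(0) = 1 satisfies D(T) = 1, so the dynamical component is trivial and the cyclic evolution is purely holonomic. -/
open Matrix ContinuousLinearMap
open scoped ComplexConjugate

local notation "⟪" x ", " y "⟫" => @inner ℂ _ _ x y

theorem aux_ode (ω θ : ℝ → ℝ) (hω : ∀ t, HasDerivAt θ (ω t) t) (h0 : θ 0 = 0) (c : ℂ)
    (g : ℝ → ℂ) (hg : ∀ t, HasDerivAt g (g t * (-Complex.I * ((ω t : ℂ) * c))) t) (T : ℝ)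
    (hT : Complex.exp (Complex.I * c * (θ T : ℂ)) = 1) : g T = g 0 := by
  have hd : ∀ t, HasDerivAt (fun s => g s * Complex.exp (Complex.I * c * (θ s : ℂ))) 0 t := by
    intro t
    have h1 : HasDerivAt (fun s => Complex.I * c * (θ s : ℂ)) (Complex.I * c * (ω t : ℂ)) t :=
      ((hω t).ofReal_comp).const_mul _
    have h2 := (hg t).mul h1.cexp
    refine h2.congr_deriv ?_
    ring
  have hc := is_const_of_deriv_eq_zero (fun t => (hd t).differentiableAt)
    (fun t => (hd t).deriv) T 0
  simpa [hT, h0] using hc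

/-- Purely holonomic evolution in the one-parameter example: under the conditions
`(E2-E1)θ(T) = 2πN` and `|a1|² = m/N - E1/(E2-E1)`, the two-dimensional evolution is
cyclic and its dynamical component is trivial. -/
theorem one_parameter_purely_holonomic
    {E : Type*} [NormedAddCommGroup E] [InnerProductSpace ℂ E] [FiniteDimensional ℂ E]
    (v0 v1 v2 : E)
    (hv00 : ⟪v0, v0⟫ = 1) (hv11 : ⟪v1, v1⟫ = 1) (hv22 : ⟪v2, v2⟫ = 1)
    (hv01 : ⟪v0, v1⟫ = 0) (hv02 : ⟪v0, v2⟫ = 0) (hv12 : ⟪v1, v2⟫ = 0)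
    (E1 E2 : ℝ) (hE : E1 ≠ E2)
    (a1 a2 : ℂ) (hnorm : ‖a1‖ ^ 2 + ‖a2‖ ^ 2 = 1)
    (ω : ℝ → ℝ) (hωcont : Continuous ω)
    (θ : ℝ → ℝ) (hθ : ∀ t, θ t = ∫ s in (0:ℝ)..t, ω s)
    (H : ℝ → E →L[ℂ] E)
    (hH : ∀ t, H t = (ω t : ℂ) • ((E1 : ℂ) • ketbra v1 v1 + (E2 : ℂ) • ketbra v2 v2))
    (ψ : Fin 2 → ℝ → E)
    (hψ1 : ∀ t, ψ 0 t = v0)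
    (hψ2 : ∀ t, ψ 1 t =
      (conj a2 * Complex.exp (-Complex.I * (E1 : ℂ) * (θ t : ℂ))) • v1 -
        (conj a1 * Complex.exp (-Complex.I * (E2 : ℂ) * (θ t : ℂ))) • v2)
    (F : ℝ → Matrix (Fin 2) (Fin 2) ℂ)
    (hF : ∀ t i j, F t i j = -Complex.I * ⟪ψ i t, (H t) (ψ j t)⟫)
    (T : ℝ) (N m : ℤ) (hN : N ≠ 0)
    (hcond1 : (E2 - E1) * θ T = 2 * Real.pi * N)
    (hcond2 : ‖a1‖ ^ 2 = (m : ℝ) / (N : ℝ) - E1 / (E2 - E1)) :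
    (ψ 0 T = ψ 0 0 ∧
      ψ 1 T = Complex.exp (-(((2 * Real.pi * (N : ℝ) * E1 / (E2 - E1) : ℝ)) : ℂ)
        * Complex.I) • ψ 1 0) ∧
    (∀ D : ℝ → Matrix (Fin 2) (Fin 2) ℂ,
      (∀ t i j, HasDerivAt (fun s => D s i j) ((D t * F t) i j) t) →
      D 0 = 1 → D T = 1) := by
  have hv10 : ⟪v1, v0⟫ = 0 := by rw [← inner_conj_symm, hv01, map_zero]
  have hv20 : ⟪v2, v0⟫ = 0 := by rw [← inner_conj_symm, hv02, map_zero]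
  have hv21 : ⟪v2, v1⟫ = 0 := by rw [← inner_conj_symm, hv12, map_zero]
  have hθ0 : θ 0 = 0 := by rw [hθ]; simp
  have hθd : ∀ t, HasDerivAt θ (ω t) t := by
    intro t
    have : θ = fun t => ∫ s in (0:ℝ)..t, ω s := funext hθ
    rw [this]
    exact intervalIntegral.integral_hasDerivAt_right (hωcont.intervalIntegrable _ _)
      (hωcont.stronglyMeasurableAtFilter _ _) hωcont.continuousAt
  have hE' : E2 - E1 ≠ 0 := sub_ne_zero.mpr hE.symm
  have hNr : (N : ℝ) ≠ 0 := by exact_mod_cast hN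
  refine ⟨⟨by rw [hψ1, hψ1], ?_⟩, ?_⟩
  · have e1 : (2 * Real.pi * (N : ℝ) * E1 / (E2 - E1) : ℝ) = E1 * θ T := by
      rw [← hcond1]; field_simp
    have e2 : Complex.exp (-Complex.I * (E2 : ℂ) * (θ T : ℂ))
        = Complex.exp (-Complex.I * (E1 : ℂ) * (θ T : ℂ)) := by
      rw [Complex.exp_eq_exp_iff_exists_int]
      refine ⟨-N, ?_⟩
      have h : ((E2 : ℂ) - E1) * θ T = 2 * Real.pi * N := by exact_mod_cast hcond1
      push_cast
      linear_combination (-Complex.I) * h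
    have e3 : -((E1 * θ T : ℝ) : ℂ) * Complex.I = -Complex.I * (E1 : ℂ) * (θ T : ℂ) := by
      push_cast; ring
    rw [e1, e3, hψ2, hψ2, e2, hθ0, smul_sub, smul_smul, smul_smul]
    simp [mul_comm]
  · intro D hD hD0
    have hF0 : ∀ t i, F t i 0 = 0 := by
      intro t i
      rw [hF, hψ1, hH]
      simp [ketbra, hv10, hv20]
    have hF01 : ∀ t, F t 0 1 = 0 := by
      intro t
      rw [hF, hψ1, hH]
      simp [ketbra, inner_add_right, inner_smul_right, hv01, hv02]
    have hex : ∀ x : ℝ, conj (Complex.exp (-Complex.I * (x : ℂ))) * Complex.exp (-Complex.I * (x : ℂ)) = 1 := by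
      intro x
      rw [← Complex.exp_conj, ← Complex.exp_add]
      simp
    have hF11 : ∀ t, F t 1 1 = -Complex.I * ((ω t : ℂ) *
        ((E1 * ‖a2‖ ^ 2 + E2 * ‖a1‖ ^ 2 : ℝ) : ℂ)) := by
      intro t
      have x1 := hex (E1 * θ t)
      have x2 := hex (E2 * θ t)
      have n1 : a1 * conj a1 = (‖a1‖ : ℂ) ^ 2 := Complex.mul_conj' a1
      have n2 : a2 * conj a2 = (‖a2‖ : ℂ) ^ 2 := Complex.mul_conj' a2
      push_cast at x1 x2
      rw [← mul_assoc] at x1 x2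
      rw [hF, hψ2, hH]
      generalize Complex.exp (-Complex.I * (E1 : ℂ) * (θ t : ℂ)) = p at *
      generalize Complex.exp (-Complex.I * (E2 : ℂ) * (θ t : ℂ)) = q at *
      simp only [ketbra, ContinuousLinearMap.smul_apply, ContinuousLinearMap.add_apply,
        ContinuousLinearMap.smulRight_apply, innerSL_apply_apply, inner_sub_left, inner_sub_right,
        inner_add_right, inner_smul_left, inner_smul_right, hv11, hv22, hv12, hv21, map_mul,
        Complex.conj_conj]
      push_cast
      rw [← n1, ← n2]
      linear_combination (-Complex.I * ω t * E1 * a2 * conj a2) * x1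
        + (-Complex.I * ω t * E2 * a1 * conj a1) * x2
    have hc : Complex.exp (Complex.I * ((E1 * ‖a2‖ ^ 2 + E2 * ‖a1‖ ^ 2 : ℝ) : ℂ) * (θ T : ℂ)) = 1 := by
      rw [Complex.exp_eq_one_iff]
      refine ⟨m, ?_⟩
      have h1 : (E1 * ‖a2‖ ^ 2 + E2 * ‖a1‖ ^ 2) * θ T = m * (2 * Real.pi) := by
        have h2 : ‖a2‖ ^ 2 = 1 - ‖a1‖ ^ 2 := by linarith
        have h3 : θ T = 2 * Real.pi * N / (E2 - E1) := by
          rw [← hcond1]; field_simp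
        rw [h2, hcond2, h3]
        field_simp
        ring
      have h2 : (((E1 * ‖a2‖ ^ 2 + E2 * ‖a1‖ ^ 2 : ℝ) : ℂ)) * (θ T : ℂ) = m * (2 * Real.pi) := by
        exact_mod_cast h1
      linear_combination Complex.I * h2
    have key0 : ∀ i, D T i 0 = D 0 i 0 := by
      intro i
      refine aux_ode ω θ hθd hθ0 0 (fun s => D s i 0) (fun t => ?_) T (by simp)
      refine (hD t i 0).congr_deriv ?_
      simp [Matrix.mul_apply, Fin.sum_univ_two, hF0]
    have key1 : ∀ i, D T i 1 = D 0 i 1 := by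
      intro i
      refine aux_ode ω θ hθd hθ0 _ (fun s => D s i 1) (fun t => ?_) T hc
      refine (hD t i 1).congr_deriv ?_
      rw [Matrix.mul_apply, Fin.sum_univ_two, hF01, hF11, mul_zero, zero_add]
    rw [← hD0]
    ext i j
    fin_cases j
    · exact key0 i
    · exact key1 i
end
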